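/- A KKT point (x, μ) of the trust-region subproblem (T) is a local-nonglobal minimizer satisfying the second-order sufficient optimality conditions if and only if wᵀ₁q ≠ 0, μ ∈ (−λ₂, −λ₁), and s′(μ) > 0. Moreover, (T) has at most one local-nonglobal minimizer. -/

import Mathlib

open Matrix Complex
open scoped Classical

noncomputable section

/-- Euclidean norm of a vector in `ℝⁿ`. -/
def euclNorm {n : ℕ} (x : Fin n → ℝ) : ℝ := Real.sqrt (x ⬝ᵥ x)

/-- The quadratic objective `f(x) = ½ xᵀPx + qᵀx`. -/
def qobj {n : ℕ} (P : Matrix (Fin n) (Fin n) ℝ) (q : Fin n → ℝ) (x : Fin n → ℝ) : ℝ :=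
  (1 / 2) * (x ⬝ᵥ P.mulVec x) + q ⬝ᵥ x

/-- The block matrix `M = [[-P, qqᵀ/r²], [I, -P]]`. -/
def trsM {n : ℕ} (P : Matrix (Fin n) (Fin n) ℝ) (q : Fin n → ℝ) (r : ℝ) :
    Matrix (Fin n ⊕ Fin n) (Fin n ⊕ Fin n) ℝ :=
  Matrix.fromBlocks (-P) ((r ^ 2)⁻¹ • Matrix.vecMulVec q q) 1 (-P)

/-- The complexification of `M`. -/
def trsMC {n : ℕ} (P : Matrix (Fin n) (Fin n) ℝ) (q : Fin n → ℝ) (r : ℝ) :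
    Matrix (Fin n ⊕ Fin n) (Fin n ⊕ Fin n) ℂ :=
  (trsM P q r).map Complex.ofReal

/-- `μ ∈ ℂ` is an eigenvalue of the complex matrix `A`. -/
def IsEig {m : Type*} [Fintype m] (A : Matrix m m ℂ) (μ : ℂ) : Prop :=
  ∃ v : m → ℂ, v ≠ 0 ∧ A.mulVec v = μ • v

/-- The secular function `s(z) = Σᵢ (wᵢᵀq)²/(λᵢ + z)² - r²` on `ℂ`. -/
def secular {n : ℕ} (lam : Fin n → ℝ) (w : Fin n → Fin n → ℝ) (q : Fin n → ℝ) (r : ℝ)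
    (z : ℂ) : ℂ :=
  (∑ i, ((w i ⬝ᵥ q : ℝ) : ℂ) ^ 2 / (((lam i : ℝ) : ℂ) + z) ^ 2) - (r : ℂ) ^ 2

/-- The secular function on `ℝ`. -/
def secularR {n : ℕ} (lam : Fin n → ℝ) (w : Fin n → Fin n → ℝ) (q : Fin n → ℝ) (r : ℝ)
    (t : ℝ) : ℝ :=
  (∑ i, (w i ⬝ᵥ q) ^ 2 / (lam i + t) ^ 2) - r ^ 2

/-- The derivative of the secular function, `s'(t) = -2 Σᵢ (wᵢᵀq)²/(λᵢ + t)³`. -/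
def secularDeriv {n : ℕ} (lam : Fin n → ℝ) (w : Fin n → Fin n → ℝ) (q : Fin n → ℝ)
    (t : ℝ) : ℝ :=
  -2 * ∑ i, (w i ⬝ᵥ q) ^ 2 / (lam i + t) ^ 3

/-- `z` is not a pole of the secular function (the poles are the `-λᵢ` with `wᵢᵀq ≠ 0`). -/
def IsNonpole {n : ℕ} (lam : Fin n → ℝ) (w : Fin n → Fin n → ℝ) (q : Fin n → ℝ) (z : ℂ) : Prop :=
  ∀ i, w i ⬝ᵥ q ≠ 0 → z ≠ -((lam i : ℝ) : ℂ)

/-- `f` has a zero of order exactly `k` at `z`. -/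
def HasZeroOfOrder (f : ℂ → ℂ) (z : ℂ) (k : ℕ) : Prop :=
  ∃ g : ℂ → ℂ, AnalyticAt ℂ g z ∧ g z ≠ 0 ∧ ∀ᶠ u in nhds z, f u = (u - z) ^ k * g u

end

open Filter Topology

section EuclideanNorm

variable {n : ℕ}

lemma euclNorm_eq_iff {x : Fin n → ℝ} {r : ℝ} (hr : 0 < r) :
    euclNorm x = r ↔ x ⬝ᵥ x = r ^ 2 := by
  have h0 : 0 ≤ x ⬝ᵥ x := Finset.sum_nonneg fun i _ => mul_self_nonneg (x i)
  unfold euclNorm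
  constructor
  · rintro rfl
    exact (Real.sq_sqrt h0).symm
  · intro h
    rw [h, Real.sqrt_sq hr.le]

lemma dotProduct_self_pos' {v : Fin n → ℝ} (hv : v ≠ 0) : 0 < v ⬝ᵥ v := by
  have h0 : 0 ≤ v ⬝ᵥ v := Finset.sum_nonneg fun i _ => mul_self_nonneg (v i)
  exact lt_of_le_of_ne h0 fun h => hv (dotProduct_self_eq_zero.mp h.symm)

lemma Matrix.IsSymm.dotProduct_mulVec_comm {P : Matrix (Fin n) (Fin n) ℝ} (hP : P.IsSymm)
    (u v : Fin n → ℝ) : u ⬝ᵥ P.mulVec v = v ⬝ᵥ P.mulVec u := by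
  rw [Matrix.dotProduct_mulVec, ← Matrix.mulVec_transpose, hP.eq, dotProduct_comm]

lemma qobj_add {P : Matrix (Fin n) (Fin n) ℝ} (hP : P.IsSymm) (q x h : Fin n → ℝ) :
    qobj P q (x + h) - qobj P q x = h ⬝ᵥ (P.mulVec x + q) + (1 / 2) * (h ⬝ᵥ P.mulVec h) := by
  simp only [qobj, Matrix.mulVec_add, dotProduct_add, add_dotProduct]
  rw [hP.dotProduct_mulVec_comm x h, dotProduct_comm q h]
  ring

/-- On the sphere, the objective gap at a KKT point is a quadratic form. -/
lemma qobj_sub_of_kkt {P : Matrix (Fin n) (Fin n) ℝ} (hP : P.IsSymm) {q x h : Fin n → ℝ} {μ : ℝ}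
    (hK : P.mulVec x + q + μ • x = 0) (hs : (x + h) ⬝ᵥ (x + h) = x ⬝ᵥ x) :
    qobj P q (x + h) - qobj P q x = (1 / 2) * (h ⬝ᵥ P.mulVec h + μ * (h ⬝ᵥ h)) := by
  rw [qobj_add hP, eq_neg_of_add_eq_zero_left hK]
  simp only [dotProduct_add, add_dotProduct] at hs
  rw [dotProduct_comm x h] at hs
  simp only [dotProduct_neg, dotProduct_smul, smul_eq_mul]
  linear_combination (-μ / 2) * hs

/-- Reflection of `y` in the hyperplane orthogonal to `v`. -/
noncomputable def hyperplaneReflection (y v : Fin n → ℝ) : Fin n → ℝ :=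
  y + (-(2 * (y ⬝ᵥ v) / (v ⬝ᵥ v))) • v

lemma hyperplaneReflection_dotProduct_self (y v : Fin n → ℝ) :
    hyperplaneReflection y v ⬝ᵥ hyperplaneReflection y v = y ⬝ᵥ y := by
  unfold hyperplaneReflection
  by_cases hv : v = 0
  · simp [hv]
  have := (dotProduct_self_pos' hv).ne'
  simp only [dotProduct_add, add_dotProduct, dotProduct_smul, smul_dotProduct, smul_eq_mul]
  rw [dotProduct_comm v y]
  field_simp
  ring

lemma qobj_reflection_sub {P : Matrix (Fin n) (Fin n) ℝ} (hP : P.IsSymm) {q y : Fin n → ℝ} {μ : ℝ}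
    (hK : P.mulVec y + q + μ • y = 0) (v : Fin n → ℝ) :
    qobj P q (hyperplaneReflection y v) - qobj P q y =
      2 * ((y ⬝ᵥ v) / (v ⬝ᵥ v)) ^ 2 * (v ⬝ᵥ P.mulVec v + μ * (v ⬝ᵥ v)) := by
  have hs := hyperplaneReflection_dotProduct_self y v
  unfold hyperplaneReflection at hs ⊢
  rw [qobj_sub_of_kkt hP hK hs]
  simp only [Matrix.mulVec_smul, dotProduct_smul, smul_dotProduct, smul_eq_mul]
  ring

lemma eventually_qobj_le_reflection {P : Matrix (Fin n) (Fin n) ℝ} {q y : Fin n → ℝ} {r : ℝ}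
    (hy : euclNorm y = r) (hmin : IsLocalMinOn (qobj P q) {v | euclNorm v = r} y)
    {d : Fin n → ℝ} (hd : d ≠ 0) (hdy : d ⬝ᵥ y = 0) (e : Fin n → ℝ) :
    ∀ᶠ t in 𝓝 (0 : ℝ), qobj P q y ≤ qobj P q (hyperplaneReflection y (d + t • e)) := by
  have ht : Tendsto (fun t : ℝ => hyperplaneReflection y (d + t • e)) (𝓝 0)
      (𝓝[{v | euclNorm v = r}] y) := by
    refine tendsto_nhdsWithin_iff.mpr ⟨?_, Eventually.of_forall fun t => ?_⟩
    · have hv : Continuous fun t : ℝ => d + t • e := by fun_prop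
      have h1 : Continuous fun t : ℝ => y ⬝ᵥ (d + t • e) := continuous_const.dotProduct hv
      have h2 : Continuous fun t : ℝ => (d + t • e) ⬝ᵥ (d + t • e) := hv.dotProduct hv
      have hc : ContinuousAt (fun t : ℝ => hyperplaneReflection y (d + t • e)) 0 := by
        have h3 : ContinuousAt (fun t : ℝ => 2 * (y ⬝ᵥ (d + t • e)) /
            ((d + t • e) ⬝ᵥ (d + t • e))) 0 := by
          refine (continuousAt_const.mul h1.continuousAt).div h2.continuousAt ?_
          simpa using hd
        exact continuousAt_const.add (h3.neg.smul hv.continuousAt)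
      have h0 : hyperplaneReflection y (d + (0 : ℝ) • e) = y := by
        simp [hyperplaneReflection, dotProduct_comm y d, hdy]
      have := hc.tendsto
      rwa [h0] at this
    · change euclNorm _ = r
      rw [← hy]
      simp only [euclNorm, hyperplaneReflection_dotProduct_self]
  exact ht.eventually hmin

/-- Local minimizers on the sphere are KKT points. -/
lemma exists_multiplier {P : Matrix (Fin n) (Fin n) ℝ} (hP : P.IsSymm) {q y : Fin n → ℝ} {r : ℝ}
    (hr : 0 < r) (hy : euclNorm y = r)
    (hmin : IsLocalMinOn (qobj P q) {v | euclNorm v = r} y) :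
    ∃ μ : ℝ, P.mulVec y + q + μ • y = 0 := by
  have hyy : 0 < y ⬝ᵥ y := by rw [(euclNorm_eq_iff hr).mp hy]; positivity
  set g := P.mulVec y + q with hg
  refine ⟨-(g ⬝ᵥ y) / (y ⬝ᵥ y), ?_⟩
  by_contra hd
  set d := g + (-(g ⬝ᵥ y) / (y ⬝ᵥ y)) • y with hdd
  have hdy : d ⬝ᵥ y = 0 := by
    rw [hdd, add_dotProduct, smul_dotProduct, smul_eq_mul]
    field_simp
    ring
  have hdd_pos := dotProduct_self_pos' hd
  have hdg : d ⬝ᵥ g = d ⬝ᵥ d := by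
    have : g = d - (-(g ⬝ᵥ y) / (y ⬝ᵥ y)) • y := by rw [hdd]; abel
    conv_lhs => rw [this]
    rw [dotProduct_sub, dotProduct_smul, hdy]
    simp
  have hv : Continuous fun t : ℝ => d + t • y := by fun_prop
  have hvg : Continuous fun t : ℝ => (d + t • y) ⬝ᵥ g := hv.dotProduct continuous_const
  have hvv : Continuous fun t : ℝ => (d + t • y) ⬝ᵥ (d + t • y) := hv.dotProduct hv
  have hvP : Continuous fun t : ℝ => (d + t • y) ⬝ᵥ P.mulVec (d + t • y) :=
    hv.dotProduct (continuous_const.matrix_mulVec hv)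
  have hcont : Continuous fun t : ℝ => -((d + t • y) ⬝ᵥ (d + t • y)) * ((d + t • y) ⬝ᵥ g)
      + t * (y ⬝ᵥ y) * ((d + t • y) ⬝ᵥ P.mulVec (d + t • y)) := by fun_prop
  have hlim := (hcont.tendsto 0).mono_left (nhdsWithin_le_nhds (s := Set.Ioi 0))
  have hnonneg := ge_of_tendsto hlim (b := 0) (by
    filter_upwards [(eventually_qobj_le_reflection hy hmin hd hdy y).filter_mono
      nhdsWithin_le_nhds, self_mem_nhdsWithin] with t ht ht0
    have ht0 : 0 < t := ht0
    have hvpos : 0 < (d + t • y) ⬝ᵥ (d + t • y) := by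
      simp only [dotProduct_add, add_dotProduct, dotProduct_smul, smul_dotProduct, smul_eq_mul,
        dotProduct_comm y d, hdy]
      positivity
    have hyv : y ⬝ᵥ (d + t • y) = t * (y ⬝ᵥ y) := by
      simp [dotProduct_comm y d, hdy]
    have key := qobj_add hP q y ((-(2 * (y ⬝ᵥ (d + t • y)) /
      ((d + t • y) ⬝ᵥ (d + t • y)))) • (d + t • y))
    rw [← hyperplaneReflection, ← hg, hyv] at key
    simp only [Matrix.mulVec_smul, smul_dotProduct, dotProduct_smul, smul_eq_mul] at key
    generalize (d + t • y) ⬝ᵥ (d + t • y) = V at *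
    generalize (d + t • y) ⬝ᵥ g = G at *
    generalize (d + t • y) ⬝ᵥ P.mulVec (d + t • y) = H at *
    have h1 : 0 ≤ (2 * t * (y ⬝ᵥ y) / V ^ 2) * (-V * G + t * (y ⬝ᵥ y) * H) := by
      have h2 := sub_nonneg.mpr ht
      rw [key] at h2
      refine h2.trans_eq ?_
      field_simp
    exact nonneg_of_mul_nonneg_right h1 (by positivity))
  simp only [zero_smul, add_zero, zero_mul, hdg] at hnonneg
  nlinarith

lemma eventually_quad_nonneg {P : Matrix (Fin n) (Fin n) ℝ} (hP : P.IsSymm) {q y : Fin n → ℝ}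
    {r μ : ℝ} (hy : euclNorm y = r)
    (hmin : IsLocalMinOn (qobj P q) {v | euclNorm v = r} y)
    (hK : P.mulVec y + q + μ • y = 0)
    {d e : Fin n → ℝ} (hd : d ≠ 0) (hdy : d ⬝ᵥ y = 0) (hey : e ⬝ᵥ y ≠ 0) :
    ∀ᶠ t in 𝓝[≠] (0 : ℝ),
      0 ≤ (d + t • e) ⬝ᵥ P.mulVec (d + t • e) + μ * ((d + t • e) ⬝ᵥ (d + t • e)) := by
  filter_upwards [(eventually_qobj_le_reflection hy hmin hd hdy e).filter_mono
      nhdsWithin_le_nhds, self_mem_nhdsWithin] with t ht ht0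
  have ht0 : t ≠ 0 := ht0
  have h1 := qobj_reflection_sub hP hK (d + t • e)
  have h2 := sub_nonneg.mpr ht
  rw [h1] at h2
  have hyv : y ⬝ᵥ (d + t • e) ≠ 0 := by
    rw [dotProduct_comm, add_dotProduct, smul_dotProduct, hdy, zero_add, smul_eq_mul]
    exact mul_ne_zero ht0 hey
  have hv : d + t • e ≠ 0 := fun h => hyv (by rw [h, dotProduct_zero])
  have hvv := dotProduct_self_pos' hv
  exact nonneg_of_mul_nonneg_right h2 (by positivity)

/-- Second-order necessary optimality conditions on the sphere. -/
lemma second_order_necessary {P : Matrix (Fin n) (Fin n) ℝ} (hP : P.IsSymm) {q y : Fin n → ℝ}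
    {r μ : ℝ} (hr : 0 < r) (hy : euclNorm y = r)
    (hmin : IsLocalMinOn (qobj P q) {v | euclNorm v = r} y)
    (hK : P.mulVec y + q + μ • y = 0) (d : Fin n → ℝ) (hdy : d ⬝ᵥ y = 0) :
    0 ≤ d ⬝ᵥ P.mulVec d + μ * (d ⬝ᵥ d) := by
  by_cases hd : d = 0
  · simp [hd]
  have hyy : y ⬝ᵥ y ≠ 0 := by rw [(euclNorm_eq_iff hr).mp hy]; positivity
  have hv : Continuous fun t : ℝ => d + t • y := by fun_prop
  have hvv : Continuous fun t : ℝ => (d + t • y) ⬝ᵥ (d + t • y) := hv.dotProduct hv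
  have hvP : Continuous fun t : ℝ => (d + t • y) ⬝ᵥ P.mulVec (d + t • y) :=
    hv.dotProduct (continuous_const.matrix_mulVec hv)
  have hcont : Continuous fun t : ℝ => (d + t • y) ⬝ᵥ P.mulVec (d + t • y)
      + μ * ((d + t • y) ⬝ᵥ (d + t • y)) := by fun_prop
  have hlim := (hcont.tendsto 0).mono_left (nhdsWithin_le_nhds (s := {0}ᶜ))
  have := ge_of_tendsto hlim (eventually_quad_nonneg hP hy hmin hK hd hdy hyy)
  simpa using this

/-- Second-order sufficient optimality conditions on the sphere. -/
lemma isLocalMinOn_of_second_order {P : Matrix (Fin n) (Fin n) ℝ} (hP : P.IsSymm)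
    {q x : Fin n → ℝ} {r μ : ℝ} (hr : 0 < r) (hx : euclNorm x = r)
    (hK : P.mulVec x + q + μ • x = 0)
    (hpos : ∀ d : Fin n → ℝ, d ≠ 0 → d ⬝ᵥ x = 0 → 0 < d ⬝ᵥ P.mulVec d + μ * (d ⬝ᵥ d)) :
    IsLocalMinOn (qobj P q) {y | euclNorm y = r} x := by
  have hid : Continuous fun u : Fin n → ℝ => u := continuous_id
  have hcd : Continuous fun u : Fin n → ℝ => u ⬝ᵥ u := hid.dotProduct hid
  have hcP : Continuous fun u : Fin n → ℝ => u ⬝ᵥ P.mulVec u :=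
    hid.dotProduct (continuous_const.matrix_mulVec hid)
  have hcx : Continuous fun u : Fin n → ℝ => (u ⬝ᵥ x) ^ 2 :=
    (hid.dotProduct continuous_const).pow 2
  have hcQ : Continuous fun u : Fin n → ℝ => u ⬝ᵥ P.mulVec u + μ * (u ⬝ᵥ u) := by fun_prop
  set K : Set (Fin n → ℝ) := {u | u ⬝ᵥ u = 1 ∧ u ⬝ᵥ P.mulVec u + μ * (u ⬝ᵥ u) ≤ 0}
  have hKc : IsCompact K := by
    refine Metric.isCompact_of_isClosed_isBounded
      ((isClosed_eq hcd continuous_const).inter (isClosed_le hcQ continuous_const)) ?_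
    refine (Metric.isBounded_closedBall (x := (0 : Fin n → ℝ)) (r := 1)).subset fun u hu => ?_
    rw [mem_closedBall_zero_iff, pi_norm_le_iff_of_nonneg zero_le_one]
    intro i
    have h1 : u i * u i ≤ u ⬝ᵥ u :=
      Finset.single_le_sum (f := fun i => u i * u i) (fun i _ => mul_self_nonneg (u i))
        (Finset.mem_univ i)
    rw [hu.1] at h1
    rw [Real.norm_eq_abs]
    exact abs_le_one_iff_mul_self_le_one.mpr h1
  obtain ⟨m, hm, hmK⟩ : ∃ m : ℝ, 0 < m ∧ ∀ u ∈ K, m ≤ (u ⬝ᵥ x) ^ 2 := by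
    rcases K.eq_empty_or_nonempty with hE | hN
    · exact ⟨1, one_pos, by simp [hE]⟩
    · obtain ⟨u, hu, hmin⟩ := hKc.exists_isMinOn hN hcx.continuousOn
      refine ⟨(u ⬝ᵥ x) ^ 2, ?_, fun v hv => hmin hv⟩
      have hux : u ⬝ᵥ x ≠ 0 := fun h => by
        have hu0 : u ≠ 0 := by
          rintro rfl
          simpa using hu.1
        exact absurd (hpos u hu0 h) (not_lt.mpr hu.2)
      positivity
  have hnear : ∀ᶠ y in 𝓝[{y | euclNorm y = r}] x, (y - x) ⬝ᵥ (y - x) < 4 * m := by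
    have hsub : Continuous fun y : Fin n → ℝ => y - x := by fun_prop
    have hc : Continuous fun y : Fin n → ℝ => (y - x) ⬝ᵥ (y - x) := hsub.dotProduct hsub
    refine ((hc.tendsto x).eventually (gt_mem_nhds ?_)).filter_mono nhdsWithin_le_nhds
    simpa using hm
  filter_upwards [hnear, self_mem_nhdsWithin] with y hy hyr
  have hyr : euclNorm y = r := hyr
  obtain ⟨h, rfl⟩ : ∃ h, y = x + h := ⟨y - x, by abel⟩
  rw [add_sub_cancel_left] at hy
  have hs : (x + h) ⬝ᵥ (x + h) = x ⬝ᵥ x := by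
    rw [(euclNorm_eq_iff hr).mp hyr, (euclNorm_eq_iff hr).mp hx]
  have hgap := qobj_sub_of_kkt hP hK hs
  by_cases hh : h = 0
  · simp [hh]
  have hhh := dotProduct_self_pos' hh
  have hhx : h ⬝ᵥ x = -(h ⬝ᵥ h) / 2 := by
    simp only [dotProduct_add, add_dotProduct, dotProduct_comm x h] at hs
    linarith
  by_contra hlt
  push Not at hlt
  have hQ : h ⬝ᵥ P.mulVec h + μ * (h ⬝ᵥ h) ≤ 0 := by linarith
  have hsq : √(h ⬝ᵥ h) ^ 2 = h ⬝ᵥ h := Real.sq_sqrt hhh.le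
  have hmem : (√(h ⬝ᵥ h))⁻¹ • h ∈ K := by
    have hsc : (√(h ⬝ᵥ h))⁻¹ * (√(h ⬝ᵥ h))⁻¹ = (h ⬝ᵥ h)⁻¹ := by
      rw [← mul_inv, ← sq, hsq]
    constructor
    · simp only [dotProduct_smul, smul_dotProduct, smul_eq_mul]
      rw [← mul_assoc, hsc, inv_mul_cancel₀ hhh.ne']
    · simp only [Matrix.mulVec_smul, dotProduct_smul, smul_dotProduct, smul_eq_mul]
      have : (h ⬝ᵥ h)⁻¹ * (h ⬝ᵥ P.mulVec h + μ * (h ⬝ᵥ h)) ≤ 0 :=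
        mul_nonpos_of_nonneg_of_nonpos (by positivity) hQ
      refine le_of_eq_of_le ?_ this
      linear_combination (h ⬝ᵥ P.mulVec h + μ * (h ⬝ᵥ h)) * hsc
  have := hmK _ hmem
  rw [smul_dotProduct, smul_eq_mul, hhx, mul_pow, inv_pow, hsq] at this
  have h3 : (h ⬝ᵥ h)⁻¹ * (-(h ⬝ᵥ h) / 2) ^ 2 = (h ⬝ᵥ h) / 4 := by
    field_simp
    ring
  linarith

end EuclideanNorm

section SpectralCoordinates

variable {n : ℕ}

lemma dotProduct_eq_sum_coords {w : Fin n → Fin n → ℝ}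
    (horth : ∀ i j, w i ⬝ᵥ w j = if i = j then (1 : ℝ) else 0) (u v : Fin n → ℝ) :
    u ⬝ᵥ v = ∑ i, (w i ⬝ᵥ u) * (w i ⬝ᵥ v) := by
  have h1 : Matrix.of w * (Matrix.of w)ᵀ = 1 := by
    ext i j
    rw [Matrix.mul_apply', Matrix.one_apply]
    exact horth i j
  have h2 := mul_eq_one_comm.mp h1
  have h3 : u ⬝ᵥ v = (Matrix.of w).mulVec u ⬝ᵥ (Matrix.of w).mulVec v := by
    rw [Matrix.dotProduct_mulVec, ← Matrix.mulVec_transpose, Matrix.mulVec_mulVec, h2,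
      Matrix.one_mulVec]
  rw [h3]
  rfl

lemma exists_of_coords {w : Fin n → Fin n → ℝ}
    (horth : ∀ i j, w i ⬝ᵥ w j = if i = j then (1 : ℝ) else 0) (α : Fin n → ℝ) :
    ∃ d : Fin n → ℝ, ∀ i, w i ⬝ᵥ d = α i := by
  refine ⟨∑ j, α j • w j, fun i => ?_⟩
  simp [dotProduct_sum, dotProduct_smul, horth]

lemma quad_eq_sum_coords {P : Matrix (Fin n) (Fin n) ℝ} (hP : P.IsSymm)
    {lam : Fin n → ℝ} {w : Fin n → Fin n → ℝ}
    (heig : ∀ i, P.mulVec (w i) = lam i • w i)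
    (horth : ∀ i j, w i ⬝ᵥ w j = if i = j then (1 : ℝ) else 0) (μ : ℝ) (d : Fin n → ℝ) :
    d ⬝ᵥ P.mulVec d + μ * (d ⬝ᵥ d) = ∑ i, (lam i + μ) * (w i ⬝ᵥ d) ^ 2 := by
  rw [dotProduct_eq_sum_coords horth d (P.mulVec d), dotProduct_eq_sum_coords horth d d,
    Finset.mul_sum, ← Finset.sum_add_distrib]
  refine Finset.sum_congr rfl fun i _ => ?_
  rw [hP.dotProduct_mulVec_comm, heig, dotProduct_smul, dotProduct_comm d, smul_eq_mul]
  ring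

lemma kkt_coord {P : Matrix (Fin n) (Fin n) ℝ} (hP : P.IsSymm)
    {lam : Fin n → ℝ} {w : Fin n → Fin n → ℝ}
    (heig : ∀ i, P.mulVec (w i) = lam i • w i) {q x : Fin n → ℝ} {μ : ℝ}
    (hK : P.mulVec x + q + μ • x = 0) (i : Fin n) :
    w i ⬝ᵥ q = -((lam i + μ) * (w i ⬝ᵥ x)) := by
  have h := congrArg (w i ⬝ᵥ ·) hK
  simp only [dotProduct_add, dotProduct_smul, dotProduct_zero, smul_eq_mul] at h
  rw [hP.dotProduct_mulVec_comm, heig, dotProduct_smul, dotProduct_comm x, smul_eq_mul] at h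
  linarith

/-- Test direction: for `S = ∑_{i ≠ i₀} xᵢ² / aᵢ`, a vector orthogonal to `x` whose `i₀`
coordinate is nonzero if `S` is and whose diagonal quadratic form is `S + a_{i₀} S² / x_{i₀}²`. -/
lemma exists_orthogonal_quad_eq {a x : Fin n → ℝ} {i₀ : Fin n}
    (ha : ∀ i, i ≠ i₀ → 0 < a i) (hx : x i₀ ≠ 0) :
    ∃ d : Fin n → ℝ, ∑ i, d i * x i = 0 ∧
      d i₀ = -(∑ i ∈ Finset.univ.erase i₀, x i ^ 2 / a i) / x i₀ ∧
      ∑ i, a i * d i ^ 2 = (∑ i ∈ Finset.univ.erase i₀, x i ^ 2 / a i) +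
        a i₀ * (∑ i ∈ Finset.univ.erase i₀, x i ^ 2 / a i) ^ 2 / x i₀ ^ 2 := by
  set S := ∑ i ∈ Finset.univ.erase i₀, x i ^ 2 / a i with hS
  refine ⟨fun i => if i = i₀ then -S / x i₀ else x i / a i, ?_, by simp, ?_⟩
  · rw [← Finset.add_sum_erase _ _ (Finset.mem_univ i₀)]
    have : ∑ i ∈ Finset.univ.erase i₀, (if i = i₀ then -S / x i₀ else x i / a i) * x i = S :=
      Finset.sum_congr rfl fun i hi => by
        rw [if_neg (Finset.ne_of_mem_erase hi)]
        ring
    simp only [this, if_true]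
    field_simp
    ring
  · rw [← Finset.add_sum_erase _ _ (Finset.mem_univ i₀)]
    have : ∑ i ∈ Finset.univ.erase i₀, a i * (if i = i₀ then -S / x i₀ else x i / a i) ^ 2 = S :=
      Finset.sum_congr rfl fun i hi => by
        have := ha i (Finset.ne_of_mem_erase hi)
        rw [if_neg (Finset.ne_of_mem_erase hi)]
        field_simp
    simp only [this, if_true]
    field_simp
    ring

lemma sum_sq_div_nonpos {a x : Fin n → ℝ} {i₀ : Fin n} (ha₀ : a i₀ < 0)
    (ha : ∀ i, i ≠ i₀ → 0 < a i) (hx : x i₀ ≠ 0)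
    (h : ∀ d : Fin n → ℝ, ∑ i, d i * x i = 0 → 0 ≤ ∑ i, a i * d i ^ 2) :
    ∑ i, x i ^ 2 / a i ≤ 0 := by
  obtain ⟨d, hd, -, hq⟩ := exists_orthogonal_quad_eq ha hx
  have h1 := h d hd
  rw [hq] at h1
  rw [← Finset.add_sum_erase _ _ (Finset.mem_univ i₀)]
  have hx2 : 0 < x i₀ ^ 2 := by positivity
  have hS : 0 ≤ ∑ i ∈ Finset.univ.erase i₀, x i ^ 2 / a i := Finset.sum_nonneg fun i hi => by
    have := ha i (Finset.ne_of_mem_erase hi)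
    positivity
  generalize ∑ i ∈ Finset.univ.erase i₀, x i ^ 2 / a i = S at *
  generalize x i₀ ^ 2 = X at *
  generalize a i₀ = A at *
  have hXA : X / A < 0 := div_neg_of_pos_of_neg hx2 ha₀
  by_contra hcon
  push Not at hcon
  have hSp : 0 < S := by linarith
  have h2 : S + A * S ^ 2 / X = (X / A + S) * (A * S / X) := by
    have := ha₀.ne
    field_simp
  rw [h2] at h1
  have h3 : A * S / X < 0 := div_neg_of_neg_of_pos (mul_neg_of_neg_of_pos ha₀ hSp) hx2
  nlinarith

lemma sum_sq_div_neg {a x : Fin n → ℝ} {i₀ : Fin n} (ha₀ : a i₀ < 0)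
    (ha : ∀ i, i ≠ i₀ → 0 < a i) (hx : x i₀ ≠ 0)
    (h : ∀ d : Fin n → ℝ, d ≠ 0 → ∑ i, d i * x i = 0 → 0 < ∑ i, a i * d i ^ 2) :
    ∑ i, x i ^ 2 / a i < 0 := by
  obtain ⟨d, hd, hd₀, hq⟩ := exists_orthogonal_quad_eq ha hx
  refine lt_of_le_of_ne (sum_sq_div_nonpos ha₀ ha hx fun d hd => ?_) fun hzero => ?_
  · by_cases h0 : d = 0
    · simp [h0]
    · exact (h d h0 hd).le
  rw [← Finset.add_sum_erase _ _ (Finset.mem_univ i₀)] at hzero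
  generalize ∑ i ∈ Finset.univ.erase i₀, x i ^ 2 / a i = S at *
  have hS : S = -(x i₀ ^ 2 / a i₀) := by linarith
  have hXA : x i₀ ^ 2 / a i₀ < 0 := div_neg_of_pos_of_neg (by positivity) ha₀
  have hd0 : d ≠ 0 := by
    rintro rfl
    rw [Pi.zero_apply, eq_comm, div_eq_zero_iff] at hd₀
    rcases hd₀ with h0 | h0
    · linarith
    · exact hx h0
  have h1 := h d hd0 hd
  rw [hq, hS] at h1
  have : -(x i₀ ^ 2 / a i₀) + a i₀ * (-(x i₀ ^ 2 / a i₀)) ^ 2 / x i₀ ^ 2 = 0 := by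
    have := ha₀.ne
    field_simp
    ring
  linarith

lemma quad_pos_of_sum_sq_div_neg {a x : Fin n → ℝ} {i₀ : Fin n} (ha₀ : a i₀ < 0)
    (ha : ∀ i, i ≠ i₀ → 0 < a i) (hx : x i₀ ≠ 0) (hneg : ∑ i, x i ^ 2 / a i < 0)
    {d : Fin n → ℝ} (hd : d ≠ 0) (hdx : ∑ i, d i * x i = 0) : 0 < ∑ i, a i * d i ^ 2 := by
  rw [← Finset.add_sum_erase _ _ (Finset.mem_univ i₀)] at hneg hdx ⊢
  have hCS : (∑ i ∈ Finset.univ.erase i₀, d i * x i) ^ 2 ≤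
      (∑ i ∈ Finset.univ.erase i₀, a i * d i ^ 2) *
        ∑ i ∈ Finset.univ.erase i₀, x i ^ 2 / a i := by
    refine Finset.sum_sq_le_sum_mul_sum_of_sq_le_mul _ (fun i hi => ?_) (fun i hi => ?_)
      fun i hi => ?_
    all_goals have := ha i (Finset.ne_of_mem_erase hi)
    · positivity
    · positivity
    · exact le_of_eq (by field_simp)
  have hterm : ∀ i ∈ Finset.univ.erase i₀, 0 ≤ a i * d i ^ 2 := fun i hi => by
    have := ha i (Finset.ne_of_mem_erase hi)
    positivity
  have hD : 0 < ∑ i ∈ Finset.univ.erase i₀, a i * d i ^ 2 := by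
    refine lt_of_le_of_ne (Finset.sum_nonneg hterm) fun h0 => hd ?_
    have hz : ∀ i, i ≠ i₀ → d i = 0 := fun i hi => by
      have h1 := (Finset.sum_eq_zero_iff_of_nonneg hterm).mp h0.symm i (by simp [hi])
      have := (ha i hi).ne'
      simpa [this] using h1
    have h2 : ∑ i ∈ Finset.univ.erase i₀, d i * x i = 0 :=
      Finset.sum_eq_zero fun i hi => by rw [hz i (Finset.ne_of_mem_erase hi), zero_mul]
    funext i
    by_cases hi : i = i₀
    · subst hi
      rw [h2, add_zero] at hdx
      exact (mul_eq_zero.mp hdx).resolve_right hx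
    · exact hz i hi
  generalize ∑ i ∈ Finset.univ.erase i₀, a i * d i ^ 2 = D at *
  generalize ∑ i ∈ Finset.univ.erase i₀, x i ^ 2 / a i = S at *
  have h1 : ∑ i ∈ Finset.univ.erase i₀, d i * x i = -(d i₀ * x i₀) := by linarith
  rw [h1] at hCS
  have hX : 0 < x i₀ ^ 2 := by positivity
  have h2 : D * S < D * (-(x i₀ ^ 2 / a i₀)) := mul_lt_mul_of_pos_left (by linarith) hD
  have h3 : (d i₀ ^ 2 + D / a i₀) * x i₀ ^ 2 < 0 := by
    have : D * (-(x i₀ ^ 2 / a i₀)) = -(D / a i₀ * x i₀ ^ 2) := by ring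
    nlinarith
  have h4 : d i₀ ^ 2 + D / a i₀ < 0 := by
    by_contra hc
    push Not at hc
    nlinarith
  have h5 : a i₀ * d i₀ ^ 2 + D = a i₀ * (d i₀ ^ 2 + D / a i₀) := by
    have := ha₀.ne
    field_simp
  rw [h5]
  exact mul_pos_of_neg_of_neg ha₀ h4

/-- Tangent-line inequality for `t ↦ 1 / t²` on either side of the pole. -/
lemma inv_sq_tangent_le {a b : ℝ} (hab : 0 < a * b) :
    1 / a ^ 2 - 2 * (b - a) / a ^ 3 ≤ 1 / b ^ 2 := by
  have ha : a ≠ 0 := left_ne_zero_of_mul hab.ne'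
  have hb : b ≠ 0 := right_ne_zero_of_mul hab.ne'
  have h : 1 / b ^ 2 - (1 / a ^ 2 - 2 * (b - a) / a ^ 3) =
      (b - a) ^ 2 * (2 * (a * b) + a ^ 2) / (a ^ 4 * b ^ 2) := by
    field_simp
    ring
  have : 0 ≤ (b - a) ^ 2 * (2 * (a * b) + a ^ 2) / (a ^ 4 * b ^ 2) := by positivity
  linarith

lemma inv_sq_tangent_lt {a b : ℝ} (hab : 0 < a * b) (hne : a ≠ b) :
    1 / a ^ 2 - 2 * (b - a) / a ^ 3 < 1 / b ^ 2 := by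
  have ha : a ≠ 0 := left_ne_zero_of_mul hab.ne'
  have hb : b ≠ 0 := right_ne_zero_of_mul hab.ne'
  have h : 1 / b ^ 2 - (1 / a ^ 2 - 2 * (b - a) / a ^ 3) =
      (b - a) ^ 2 * (2 * (a * b) + a ^ 2) / (a ^ 4 * b ^ 2) := by
    field_simp
    ring
  have hba : b - a ≠ 0 := sub_ne_zero.mpr hne.symm
  have : 0 < (b - a) ^ 2 * (2 * (a * b) + a ^ 2) / (a ^ 4 * b ^ 2) := by positivity
  linarith

/-- Strict convexity of the secular function between two consecutive poles. -/
lemma secularR_lt_of_secularDeriv_nonneg {lam : Fin n → ℝ} {w : Fin n → Fin n → ℝ}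
    {q : Fin n → ℝ} (r : ℝ) {i₀ : Fin n} (hq : w i₀ ⬝ᵥ q ≠ 0) {μ ν : ℝ} (hμν : μ < ν)
    (hsign : ∀ i, 0 < (lam i + μ) * (lam i + ν)) (hs : 0 ≤ secularDeriv lam w q μ) :
    secularR lam w q r μ < secularR lam w q r ν := by
  have hlt : ∑ i, ((w i ⬝ᵥ q) ^ 2 / (lam i + μ) ^ 2
      + (ν - μ) * (-2 * ((w i ⬝ᵥ q) ^ 2 / (lam i + μ) ^ 3))) <
      ∑ i, (w i ⬝ᵥ q) ^ 2 / (lam i + ν) ^ 2 := by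
    have hrw : ∀ i, (w i ⬝ᵥ q) ^ 2 / (lam i + μ) ^ 2
        + (ν - μ) * (-2 * ((w i ⬝ᵥ q) ^ 2 / (lam i + μ) ^ 3)) = (w i ⬝ᵥ q) ^ 2 *
        (1 / (lam i + μ) ^ 2 - 2 * ((lam i + ν) - (lam i + μ)) / (lam i + μ) ^ 3) :=
      fun i => by ring
    refine Finset.sum_lt_sum (fun i _ => ?_) ⟨i₀, Finset.mem_univ _, ?_⟩
    · rw [hrw, div_eq_mul_one_div ((w i ⬝ᵥ q) ^ 2) ((lam i + ν) ^ 2)]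
      exact mul_le_mul_of_nonneg_left (inv_sq_tangent_le (hsign i)) (sq_nonneg _)
    · rw [hrw, div_eq_mul_one_div ((w i₀ ⬝ᵥ q) ^ 2) ((lam i₀ + ν) ^ 2)]
      refine mul_lt_mul_of_pos_left (inv_sq_tangent_lt (hsign i₀) ?_) (by positivity)
      intro h
      linarith
  rw [Finset.sum_add_distrib, ← Finset.mul_sum, ← Finset.mul_sum] at hlt
  unfold secularDeriv at hs
  unfold secularR
  have := mul_nonneg (sub_pos.mpr hμν).le hs
  linarith

end SpectralCoordinates

section LocalNonglobal

variable {n : ℕ} {P : Matrix (Fin n) (Fin n) ℝ} {lam : Fin n → ℝ} {w : Fin n → Fin n → ℝ}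
  {q x y : Fin n → ℝ} {r μ : ℝ}

lemma eig_add_neg_of_not_global (hP : P.IsSymm)
    (heig : ∀ i, P.mulVec (w i) = lam i • w i)
    (horth : ∀ i j, w i ⬝ᵥ w j = if i = j then (1 : ℝ) else 0)
    {i₀ : Fin n} (hi₀ : ∀ i, lam i₀ ≤ lam i) (hr : 0 < r) (hy : euclNorm y = r)
    (hK : P.mulVec y + q + μ • y = 0)
    (hng : ¬ ∀ u : Fin n → ℝ, euclNorm u = r → qobj P q y ≤ qobj P q u) :
    lam i₀ + μ < 0 := by
  by_contra hc
  push Not at hc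
  refine hng fun u hu => ?_
  obtain ⟨h, rfl⟩ : ∃ h, u = y + h := ⟨u - y, by abel⟩
  have hs : (y + h) ⬝ᵥ (y + h) = y ⬝ᵥ y := by
    rw [(euclNorm_eq_iff hr).mp hu, (euclNorm_eq_iff hr).mp hy]
  have hgap := qobj_sub_of_kkt hP hK hs
  rw [quad_eq_sum_coords hP heig horth] at hgap
  have : 0 ≤ ∑ i, (lam i + μ) * (w i ⬝ᵥ h) ^ 2 := Finset.sum_nonneg fun i _ =>
    mul_nonneg (by linarith [hi₀ i]) (sq_nonneg _)
  linarith

lemma quad_eigenvector (heig : ∀ i, P.mulVec (w i) = lam i • w i)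
    (horth : ∀ i j, w i ⬝ᵥ w j = if i = j then (1 : ℝ) else 0) (i : Fin n) :
    w i ⬝ᵥ P.mulVec (w i) + μ * (w i ⬝ᵥ w i) = lam i + μ := by
  simp [heig, dotProduct_smul, horth]

lemma eigenvector_ne_zero (horth : ∀ i j, w i ⬝ᵥ w j = if i = j then (1 : ℝ) else 0)
    (i : Fin n) : w i ≠ 0 := fun h => by
  have := horth i i
  simp [h] at this

lemma local_nonglobal_spectral (hP : P.IsSymm)
    (heig : ∀ i, P.mulVec (w i) = lam i • w i)
    (horth : ∀ i j, w i ⬝ᵥ w j = if i = j then (1 : ℝ) else 0)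
    {i₀ i₁ : Fin n} (h01 : i₀ ≠ i₁) (hi₀ : ∀ i, lam i₀ ≤ lam i)
    (hr : 0 < r) (hy : euclNorm y = r)
    (hK : P.mulVec y + q + μ • y = 0)
    (hmin : IsLocalMinOn (qobj P q) {v | euclNorm v = r} y)
    (hng : ¬ ∀ u : Fin n → ℝ, euclNorm u = r → qobj P q y ≤ qobj P q u) :
    lam i₀ + μ < 0 ∧ 0 < lam i₁ + μ ∧ w i₀ ⬝ᵥ y ≠ 0 := by
  have ha₀ := eig_add_neg_of_not_global hP heig horth hi₀ hr hy hK hng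
  have hy₀ : w i₀ ⬝ᵥ y ≠ 0 := fun h0 => by
    have := second_order_necessary hP hr hy hmin hK _ h0
    rw [quad_eigenvector heig horth] at this
    linarith
  refine ⟨ha₀, ?_, hy₀⟩
  by_contra hc
  push Not at hc
  set s := w i₁ ⬝ᵥ y with hs
  set d := s • w i₀ - (w i₀ ⬝ᵥ y) • w i₁ with hd
  have hdy : d ⬝ᵥ y = 0 := by
    simp only [hd, sub_dotProduct, smul_dotProduct, smul_eq_mul, ← hs]
    ring
  have hd0 : d ≠ 0 := fun h0 => by
    have h1 : w i₁ ⬝ᵥ d = 0 := by rw [h0, dotProduct_zero]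
    simp [hd, dotProduct_sub, dotProduct_smul, horth, h01.symm] at h1
    exact hy₀ h1
  have hne : ∀ᶠ t in 𝓝[≠] (0 : ℝ), t ≠ -s := by
    by_cases h0 : s = 0
    · simp only [h0, neg_zero]
      exact eventually_mem_nhdsWithin
    · exact eventually_ne_nhdsWithin (by simpa [eq_comm] using h0)
  obtain ⟨t, ht, hts⟩ :=
    ((eventually_quad_nonneg hP hy hmin hK hd0 hdy hy₀).and hne).exists
  have hval : (d + t • w i₀) ⬝ᵥ P.mulVec (d + t • w i₀)
      + μ * ((d + t • w i₀) ⬝ᵥ (d + t • w i₀))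
      = (lam i₀ + μ) * (s + t) ^ 2 + (lam i₁ + μ) * (w i₀ ⬝ᵥ y) ^ 2 := by
    simp only [hd, Matrix.mulVec_add, Matrix.mulVec_sub, Matrix.mulVec_smul, heig, dotProduct_add,
      add_dotProduct, dotProduct_sub, sub_dotProduct, dotProduct_smul, smul_dotProduct, horth,
      smul_eq_mul, h01, h01.symm, if_true, if_false]
    ring
  rw [hval] at ht
  have hst : s + t ≠ 0 := fun h => hts (by linarith)
  have h1 : 0 < (s + t) ^ 2 := by positivity
  have h2 := mul_neg_of_neg_of_pos ha₀ h1
  have h3 := mul_nonpos_of_nonpos_of_nonneg hc (sq_nonneg (w i₀ ⬝ᵥ y))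
  linarith

lemma secularDeriv_of_kkt (hP : P.IsSymm)
    (heig : ∀ i, P.mulVec (w i) = lam i • w i) (hK : P.mulVec x + q + μ • x = 0)
    (hne : ∀ i, lam i + μ ≠ 0) :
    secularDeriv lam w q μ = -2 * ∑ i, (w i ⬝ᵥ x) ^ 2 / (lam i + μ) := by
  unfold secularDeriv
  congr 1
  refine Finset.sum_congr rfl fun i _ => ?_
  have := hne i
  rw [kkt_coord hP heig hK]
  field_simp

lemma secularR_of_kkt (hP : P.IsSymm)
    (heig : ∀ i, P.mulVec (w i) = lam i • w i)
    (horth : ∀ i j, w i ⬝ᵥ w j = if i = j then (1 : ℝ) else 0) (hr : 0 < r)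
    (hx : euclNorm x = r) (hK : P.mulVec x + q + μ • x = 0) (hne : ∀ i, lam i + μ ≠ 0) :
    secularR lam w q r μ = 0 := by
  unfold secularR
  rw [← (euclNorm_eq_iff hr).mp hx, dotProduct_eq_sum_coords horth, sub_eq_zero]
  refine Finset.sum_congr rfl fun i _ => ?_
  have := hne i
  rw [kkt_coord hP heig hK]
  field_simp

lemma eq_of_kkt_same_multiplier (hP : P.IsSymm)
    (heig : ∀ i, P.mulVec (w i) = lam i • w i)
    (horth : ∀ i j, w i ⬝ᵥ w j = if i = j then (1 : ℝ) else 0)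
    (hx : P.mulVec x + q + μ • x = 0) (hy : P.mulVec y + q + μ • y = 0)
    (hne : ∀ i, lam i + μ ≠ 0) : x = y := by
  have hc : ∀ i, w i ⬝ᵥ (x - y) = 0 := fun i => by
    have h1 := kkt_coord hP heig hx i
    have h2 := kkt_coord hP heig hy i
    rw [h1, neg_inj] at h2
    rw [dotProduct_sub, mul_left_cancel₀ (hne i) h2, sub_self]
  have h0 : (x - y) ⬝ᵥ (x - y) = 0 := by
    rw [dotProduct_eq_sum_coords horth]
    simp [hc]
  exact sub_eq_zero.mp (dotProduct_self_eq_zero.mp h0)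

lemma local_nonglobal_secularDeriv_nonneg (hP : P.IsSymm)
    (heig : ∀ i, P.mulVec (w i) = lam i • w i)
    (horth : ∀ i j, w i ⬝ᵥ w j = if i = j then (1 : ℝ) else 0) {i₀ : Fin n}
    (hr : 0 < r) (hy : euclNorm y = r) (hK : P.mulVec y + q + μ • y = 0)
    (hmin : IsLocalMinOn (qobj P q) {v | euclNorm v = r} y)
    (ha₀ : lam i₀ + μ < 0) (ha : ∀ i, i ≠ i₀ → 0 < lam i + μ) (hy₀ : w i₀ ⬝ᵥ y ≠ 0) :
    0 ≤ secularDeriv lam w q μ := by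
  have hne : ∀ i, lam i + μ ≠ 0 := fun i => by
    by_cases hi : i = i₀
    · exact hi ▸ ha₀.ne
    · exact (ha i hi).ne'
  rw [secularDeriv_of_kkt hP heig hK hne]
  have := sum_sq_div_nonpos (a := fun i => lam i + μ) (x := fun i => w i ⬝ᵥ y) ha₀ ha hy₀
    fun α hα => by
      obtain ⟨d, hd⟩ := exists_of_coords horth α
      have h := second_order_necessary hP hr hy hmin hK d (by
        simpa only [dotProduct_eq_sum_coords horth d y, hd] using hα)
      simpa only [quad_eq_sum_coords hP heig horth, hd] using h
  linarith

lemma secularDeriv_pos_of_second_order (hP : P.IsSymm)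
    (heig : ∀ i, P.mulVec (w i) = lam i • w i)
    (horth : ∀ i j, w i ⬝ᵥ w j = if i = j then (1 : ℝ) else 0) {i₀ : Fin n}
    (hK : P.mulVec x + q + μ • x = 0)
    (hpos : ∀ d : Fin n → ℝ, d ≠ 0 → d ⬝ᵥ x = 0 → 0 < d ⬝ᵥ P.mulVec d + μ * (d ⬝ᵥ d))
    (ha₀ : lam i₀ + μ < 0) (ha : ∀ i, i ≠ i₀ → 0 < lam i + μ) (hx₀ : w i₀ ⬝ᵥ x ≠ 0) :
    0 < secularDeriv lam w q μ := by
  have hne : ∀ i, lam i + μ ≠ 0 := fun i => by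
    by_cases hi : i = i₀
    · exact hi ▸ ha₀.ne
    · exact (ha i hi).ne'
  rw [secularDeriv_of_kkt hP heig hK hne]
  have := sum_sq_div_neg (a := fun i => lam i + μ) (x := fun i => w i ⬝ᵥ x) ha₀ ha hx₀
    fun α hα0 hα => by
      obtain ⟨d, hd⟩ := exists_of_coords horth α
      have hd0 : d ≠ 0 := by
        rintro rfl
        exact hα0 (funext fun i => by simp [← hd])
      have h := hpos d hd0 (by
        simpa only [dotProduct_eq_sum_coords horth d x, hd] using hα)
      simpa only [quad_eq_sum_coords hP heig horth, hd] using h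
  linarith

lemma second_order_of_secularDeriv_pos (hP : P.IsSymm)
    (heig : ∀ i, P.mulVec (w i) = lam i • w i)
    (horth : ∀ i j, w i ⬝ᵥ w j = if i = j then (1 : ℝ) else 0) {i₀ : Fin n}
    (hK : P.mulVec x + q + μ • x = 0)
    (ha₀ : lam i₀ + μ < 0) (ha : ∀ i, i ≠ i₀ → 0 < lam i + μ) (hx₀ : w i₀ ⬝ᵥ x ≠ 0)
    (hs : 0 < secularDeriv lam w q μ) {d : Fin n → ℝ} (hd : d ≠ 0) (hdx : d ⬝ᵥ x = 0) :
    0 < d ⬝ᵥ P.mulVec d + μ * (d ⬝ᵥ d) := by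
  have hne : ∀ i, lam i + μ ≠ 0 := fun i => by
    by_cases hi : i = i₀
    · exact hi ▸ ha₀.ne
    · exact (ha i hi).ne'
  rw [secularDeriv_of_kkt hP heig hK hne] at hs
  rw [quad_eq_sum_coords hP heig horth]
  refine quad_pos_of_sum_sq_div_neg (a := fun i => lam i + μ) (x := fun i => w i ⬝ᵥ x)
    (d := fun i => w i ⬝ᵥ d) ha₀ ha hx₀ (by linarith) (fun h0 => ?_) ?_
  · refine hd (dotProduct_self_eq_zero.mp ?_)
    rw [dotProduct_eq_sum_coords horth]
    exact Finset.sum_eq_zero fun i _ => by rw [congrFun h0 i, Pi.zero_apply, zero_mul]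
  · rw [← dotProduct_eq_sum_coords horth, hdx]

end LocalNonglobal

/-- a KKT point `(x, μ)` of (T) is a local-nonglobal minimizer satisfying the
second-order sufficient optimality conditions iff `w₁ᵀq ≠ 0`, `μ ∈ (-λ₂, -λ₁)` and
`s'(μ) > 0`; moreover (T) has at most one local-nonglobal minimizer. -/
theorem stmt_3 {n : ℕ} (hn : 1 < n)
    (P : Matrix (Fin n) (Fin n) ℝ) (hP : P.IsSymm)
    (lam : Fin n → ℝ) (w : Fin n → Fin n → ℝ)
    (hmono : Monotone lam)
    (heig : ∀ i, P.mulVec (w i) = lam i • w i)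
    (horth : ∀ i j, w i ⬝ᵥ w j = if i = j then (1 : ℝ) else 0)
    (q : Fin n → ℝ) (r : ℝ) (hr : 0 < r)
    (x : Fin n → ℝ) (μ : ℝ)
    (hKKT : P.mulVec x + q + μ • x = 0)
    (hx : euclNorm x = r) :
    ((IsLocalMinOn (qobj P q) {y | euclNorm y = r} x ∧
      ¬ (∀ y : Fin n → ℝ, euclNorm y = r → qobj P q x ≤ qobj P q y) ∧
      (∀ d : Fin n → ℝ, d ≠ 0 → d ⬝ᵥ x = 0 → 0 < d ⬝ᵥ P.mulVec d + μ * (d ⬝ᵥ d)))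
      ↔ (w ⟨0, by omega⟩ ⬝ᵥ q ≠ 0 ∧
          -(lam ⟨1, hn⟩) < μ ∧ μ < -(lam ⟨0, by omega⟩) ∧
          0 < secularDeriv lam w q μ))
    ∧ (∀ y z : Fin n → ℝ,
        (euclNorm y = r ∧ IsLocalMinOn (qobj P q) {v | euclNorm v = r} y ∧
          ¬ (∀ u : Fin n → ℝ, euclNorm u = r → qobj P q y ≤ qobj P q u)) →
        (euclNorm z = r ∧ IsLocalMinOn (qobj P q) {v | euclNorm v = r} z ∧
          ¬ (∀ u : Fin n → ℝ, euclNorm u = r → qobj P q z ≤ qobj P q u)) →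
        y = z) := by
  set i₀ : Fin n := ⟨0, by omega⟩ with hi₀
  set i₁ : Fin n := ⟨1, hn⟩ with hi₁
  have h01 : i₀ ≠ i₁ := by simp [hi₀, hi₁]
  have hle₀ : ∀ i, lam i₀ ≤ lam i := fun i => hmono (Fin.mk_le_of_le_val (Nat.zero_le _))
  have hle₁ : ∀ i, i ≠ i₀ → lam i₁ ≤ lam i := fun i hi => hmono (Fin.mk_le_of_le_val
    (Nat.one_le_iff_ne_zero.mpr fun h => hi (Fin.ext h)))
  refine ⟨⟨?_, ?_⟩, ?_⟩
  · rintro ⟨hmin, hng, hpos⟩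
    obtain ⟨ha₀, ha₁, hx₀⟩ :=
      local_nonglobal_spectral hP heig horth h01 hle₀ hr hx hKKT hmin hng
    refine ⟨?_, by linarith, by linarith,
      secularDeriv_pos_of_second_order hP heig horth hKKT hpos ha₀
        (fun i hi => by linarith [hle₁ i hi]) hx₀⟩
    rw [kkt_coord hP heig hKKT]
    exact neg_ne_zero.mpr (mul_ne_zero ha₀.ne hx₀)
  · rintro ⟨hq, h1, h0, hs⟩
    have ha₀ : lam i₀ + μ < 0 := by linarith
    have hx₀ : w i₀ ⬝ᵥ x ≠ 0 := fun h => hq (by rw [kkt_coord hP heig hKKT, h]; simp)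
    have hpos : ∀ d : Fin n → ℝ, d ≠ 0 → d ⬝ᵥ x = 0 →
        0 < d ⬝ᵥ P.mulVec d + μ * (d ⬝ᵥ d) := fun d hd hdx =>
      second_order_of_secularDeriv_pos hP heig horth hKKT ha₀
        (fun i hi => by linarith [hle₁ i hi]) hx₀ hs hd hdx
    refine ⟨isLocalMinOn_of_second_order hP hr hx hKKT hpos, fun hglob => ?_, hpos⟩
    have hy := hyperplaneReflection_dotProduct_self x (w i₀)
    rw [(euclNorm_eq_iff hr).mp hx, ← euclNorm_eq_iff hr] at hy
    have hgap := qobj_reflection_sub hP hKKT (w i₀)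
    rw [quad_eigenvector heig horth, horth, if_pos rfl, div_one, dotProduct_comm] at hgap
    have hsq : 0 < (w i₀ ⬝ᵥ x) ^ 2 := by positivity
    have := hglob _ hy
    nlinarith
  · rintro y z ⟨hy, hymin, hyng⟩ ⟨hz, hzmin, hzng⟩
    obtain ⟨α, hα⟩ := exists_multiplier hP hr hy hymin
    obtain ⟨β, hβ⟩ := exists_multiplier hP hr hz hzmin
    obtain ⟨hα₀, hα₁, hy₀⟩ :=
      local_nonglobal_spectral hP heig horth h01 hle₀ hr hy hα hymin hyng
    obtain ⟨hβ₀, hβ₁, hz₀⟩ :=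
      local_nonglobal_spectral hP heig horth h01 hle₀ hr hz hβ hzmin hzng
    have hα' : ∀ i, i ≠ i₀ → 0 < lam i + α := fun i hi => by linarith [hle₁ i hi]
    have hβ' : ∀ i, i ≠ i₀ → 0 < lam i + β := fun i hi => by linarith [hle₁ i hi]
    have hsign : ∀ i, 0 < (lam i + α) * (lam i + β) := fun i => by
      by_cases hi : i = i₀
      · exact hi ▸ mul_pos_of_neg_of_neg hα₀ hβ₀
      · exact mul_pos (hα' i hi) (hβ' i hi)
    have hαne : ∀ i, lam i + α ≠ 0 := fun i => left_ne_zero_of_mul (hsign i).ne'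
    have hβne : ∀ i, lam i + β ≠ 0 := fun i => right_ne_zero_of_mul (hsign i).ne'
    have hq : w i₀ ⬝ᵥ q ≠ 0 := by
      rw [kkt_coord hP heig hα]
      exact neg_ne_zero.mpr (mul_ne_zero hα₀.ne hy₀)
    have hsα := secularR_of_kkt hP heig horth hr hy hα hαne
    have hsβ := secularR_of_kkt hP heig horth hr hz hβ hβne
    rcases lt_trichotomy α β with hlt | rfl | hlt
    · have := secularR_lt_of_secularDeriv_nonneg r hq hlt hsign
        (local_nonglobal_secularDeriv_nonneg hP heig horth hr hy hα hymin hα₀ hα' hy₀)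
      linarith
    · exact eq_of_kkt_same_multiplier hP heig horth hα hβ hαne
    · have := secularR_lt_of_secularDeriv_nonneg r hq hlt
        (fun i => by rw [mul_comm]; exact hsign i)
        (local_nonglobal_secularDeriv_nonneg hP heig horth hr hz hβ hzmin hβ₀ hβ' hz₀)
      linarith
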